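/- arXiv:1805.10847 — 2 statements merged into one kernel-verified Lean document; each statement's English description precedes it below -/
import Mathlib

section
/- For every n ≥ 3, there exists a convex polygon P of n sides whose maximum number of pairwise disjoint side disks equals ⌈n/4⌉: there exist vertices p : Fin n → ℝ² of a convex n-gon such that (i) every finite set S ⊆ Fin n whose side disks are pairwise disjoint satisfies |S| ≤ ⌈n/4⌉, and (ii) there exists such a set S with |S| = ⌈n/4⌉. -/
noncomputable section

/-- The Euclidean plane. -/
abbrev E2 := EuclideanSpace ℝ (Fin 2)

/-- The side disk with diameter the segment `pq`: the closed ball centered at the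
midpoint of `p` and `q` with radius `dist p q / 2`. -/
def sideDisk (p q : E2) : Set E2 := Metric.closedBall (midpoint ℝ p q) (dist p q / 2)

/-- The triple `(a, b, c)` is positively oriented (counter-clockwise):
the determinant of `(b - a, c - a)` is positive. -/
def Ccw (a b c : E2) : Prop :=
  0 < (b 0 - a 0) * (c 1 - a 1) - (b 1 - a 1) * (c 0 - a 0)

/-- `p : Fin n → E2` lists the vertices of a convex polygon in counter-clockwise
cyclic order: every triple `p i, p j, p k` with `i < j < k` is positively oriented. -/
def IsConvexPolygon {n : ℕ} (p : Fin n → E2) : Prop :=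
  ∀ i j k : Fin n, i < j → j < k → Ccw (p i) (p j) (p k)

/-- Cyclic successor in `Fin n` (i.e. `i + 1 (mod n)`). -/
def nxt {n : ℕ} (i : Fin n) : Fin n := ⟨((i : ℕ) + 1) % n, Nat.mod_lt _ i.pos⟩

/-- The `i`-th side disk of the polygon `p`: the disk with diameter the `i`-th side,
the segment from `p i` to `p (i+1)` (indices mod `n`). -/
def polyDisk {n : ℕ} (p : Fin n → E2) (i : Fin n) : Set E2 := sideDisk (p i) (p (nxt i))

/-- The interior of the `i`-th side disk of the polygon `p` (the corresponding open ball). -/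
def polyBall {n : ℕ} (p : Fin n → E2) (i : Fin n) : Set E2 :=
  Metric.ball (midpoint ℝ (p i) (p (nxt i))) (dist (p i) (p (nxt i)) / 2)

/-- The side-disk intersection graph `G(P)`: the simple graph on `Fin n` where distinct
`i, j` are adjacent iff the side disks `D_i` and `D_j` have a common point. -/
def sideDiskGraph {n : ℕ} (p : Fin n → E2) : SimpleGraph (Fin n) :=
  SimpleGraph.fromRel fun i j => (polyDisk p i ∩ polyDisk p j).Nonempty

/-- Thales' description of the side disk: `q` lies in it iff `pqr` is not an acute angle. -/
lemma mem_sideDisk_iff (p r q : E2) :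
    q ∈ sideDisk p r ↔ (q 0 - p 0) * (q 0 - r 0) + (q 1 - p 1) * (q 1 - r 1) ≤ 0 := by
  have hm (i : Fin 2) : (midpoint ℝ p r) i = (p i + r i) / 2 := by
    simp [midpoint_eq_smul_add]
    ring
  have h2 : dist p r / 2 = √(((p 0 - r 0) ^ 2 + (p 1 - r 1) ^ 2) / 4) := by
    rw [EuclideanSpace.dist_eq, Fin.sum_univ_two, Real.dist_eq, Real.dist_eq, sq_abs, sq_abs,
      Real.sqrt_div' _ (by norm_num), show (4 : ℝ) = 2 ^ 2 by norm_num,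
      Real.sqrt_sq (by norm_num)]
  rw [sideDisk, Metric.mem_closedBall, h2, EuclideanSpace.dist_eq, Fin.sum_univ_two,
    Real.dist_eq, Real.dist_eq, sq_abs, sq_abs, Real.sqrt_le_sqrt_iff (by positivity), hm, hm]
  constructor <;> intro h <;> nlinarith

/-- The point with abscissa `a` on the parabola `y = x ^ 2`. -/
def parabolaPoint (a : ℝ) : E2 := !₂[a, a ^ 2]

/-- The disk whose diameter is the chord of the parabola `y = x ^ 2` between the abscissas
`a` and `b`. -/
def chordDisk (a b : ℝ) : Set E2 := sideDisk (parabolaPoint a) (parabolaPoint b)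

lemma mem_chordDisk_iff (a b : ℝ) (q : E2) :
    q ∈ chordDisk a b ↔ (q 0 - a) * (q 0 - b) + (q 1 - a ^ 2) * (q 1 - b ^ 2) ≤ 0 := by
  simp [chordDisk, mem_sideDisk_iff, parabolaPoint]

lemma chordDisk_inter_mirror {a b : ℝ} (ha : 0 ≤ a) (hab : 16 * a ≤ b) (hb : 1 ≤ b) :
    (chordDisk a b ∩ chordDisk (-b) (-a)).Nonempty := by
  have h : a * b ≤ (b ^ 2 - a ^ 2) ^ 2 / 4 := by
    have h1 : b ^ 2 / 2 ≤ b ^ 2 - a ^ 2 := by nlinarith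
    have h2 : (b ^ 2 / 2) ^ 2 ≤ (b ^ 2 - a ^ 2) ^ 2 := by gcongr
    have h3 : a * b ≤ b ^ 2 / 16 := by nlinarith
    have h4 : b ^ 2 ≤ b ^ 2 * b ^ 2 := by nlinarith [one_le_pow₀ hb (n := 2)]
    nlinarith
  refine ⟨!₂[0, (a ^ 2 + b ^ 2) / 2], ?_, ?_⟩ <;> rw [mem_chordDisk_iff] <;> simp <;> nlinarith

lemma mem_chordDisk_left {a b : ℝ} (ha : 0 ≤ a) (hab : 16 * a ≤ b) (hb : 1 ≤ b) :
    !₂[b / 2, b ^ 2 + 1 / 8] ∈ chordDisk a b := by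
  rw [mem_chordDisk_iff]
  simp
  nlinarith

lemma mem_chordDisk_neg_left {a b : ℝ} (ha : 0 ≤ a) (hab : 16 * a ≤ b) (hb : 1 ≤ b) :
    !₂[-(b / 2), b ^ 2 + 1 / 8] ∈ chordDisk (-b) (-a) := by
  rw [mem_chordDisk_iff]
  simp
  nlinarith

lemma chordDisk_inter_next_mirror {a b e : ℝ} (ha : 0 ≤ a) (hab : 16 * a ≤ b) (hb : 1 ≤ b)
    (hbe : 16 * b ≤ e) :
    (chordDisk a b ∩ chordDisk (-e) (-b)).Nonempty := by
  refine ⟨_, mem_chordDisk_left ha hab hb, ?_⟩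
  rw [mem_chordDisk_iff]
  simp
  nlinarith

lemma chordDisk_mirror_inter_next {a b e : ℝ} (ha : 0 ≤ a) (hab : 16 * a ≤ b) (hb : 1 ≤ b)
    (hbe : 16 * b ≤ e) :
    (chordDisk (-b) (-a) ∩ chordDisk b e).Nonempty := by
  refine ⟨_, mem_chordDisk_neg_left ha hab hb, ?_⟩
  rw [mem_chordDisk_iff]
  simp
  nlinarith

lemma chordDisk_inter_closing {a b e : ℝ} (ha : 0 ≤ a) (hab : 16 * a ≤ b) (hb : 1 ≤ b)
    (hbe : 16 * b ≤ e) :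
    (chordDisk a b ∩ chordDisk e (-b)).Nonempty := by
  refine ⟨_, mem_chordDisk_left ha hab hb, ?_⟩
  rw [mem_chordDisk_iff]
  simp
  nlinarith

lemma snd_le_of_mem_chordDisk {a b : ℝ} {q : E2} (ha : 0 ≤ a) (hab : a ≤ b)
    (hq : q ∈ chordDisk a b) : q 1 ≤ b ^ 2 + 1 / 4 := by
  rw [mem_chordDisk_iff] at hq
  by_contra! h
  have h1 : (b - a) ^ 2 ≤ b ^ 2 - a ^ 2 := by nlinarith
  have h2 : 0 < (q 1 - b ^ 2 - 1 / 4) * (q 1 - a ^ 2) :=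
    mul_pos (by linarith) (by nlinarith)
  nlinarith [sq_nonneg (q 0 - a + (q 0 - b))]

lemma le_snd_of_mem_chordDisk {a b : ℝ} {q : E2} (ha : 0 ≤ a) (hab : a ≤ b)
    (hq : q ∈ chordDisk a b) : a ^ 2 - 1 / 4 ≤ q 1 := by
  rw [mem_chordDisk_iff] at hq
  by_contra! h
  have h1 : (b - a) ^ 2 ≤ b ^ 2 - a ^ 2 := by nlinarith
  have h2 : 0 < (a ^ 2 - 1 / 4 - q 1) * (b ^ 2 - q 1) :=
    mul_pos (by linarith) (by nlinarith)
  nlinarith [sq_nonneg (q 0 - a + (q 0 - b))]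

lemma le_snd_of_mem_chordDisk_neg {a : ℝ} {q : E2} (ha : 0 ≤ a)
    (hq : q ∈ chordDisk a (-a)) : a ^ 2 - a ≤ q 1 := by
  rw [mem_chordDisk_iff] at hq
  by_contra! h
  nlinarith [sq_nonneg (q 0), mul_pos (show 0 < a ^ 2 - a - q 1 by linarith)
    (show 0 < a ^ 2 - q 1 + a by linarith)]

/-- A sequence starting at `0` and growing at least by a factor of `16`. -/
def scale (k : ℕ) : ℝ := 16 ^ k - 1

lemma scale_nonneg (k : ℕ) : 0 ≤ scale k := by
  have := one_le_pow₀ (show (1 : ℝ) ≤ 16 by norm_num) (n := k)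
  simp only [scale]
  linarith

lemma mul_scale_le (k : ℕ) : 16 * scale k ≤ scale (k + 1) := by
  simp only [scale, pow_succ]
  linarith

lemma one_le_scale_succ (k : ℕ) : 1 ≤ scale (k + 1) := by
  have := one_le_pow₀ (show (1 : ℝ) ≤ 16 by norm_num) (n := k)
  simp only [scale, pow_succ]
  linarith

lemma scale_strictMono : StrictMono scale :=
  strictMono_nat_of_lt_succ fun k => by
    linarith [mul_scale_le k, scale_nonneg k, one_le_scale_succ k]

/-- The abscissas of the vertices: the values `scale 0, scale 1, …` to the right of index `c`
and their mirror images to the left. -/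
def abscissa (c i : ℕ) : ℝ := if c ≤ i then scale (i - c) else -scale (c - i)

lemma abscissa_of_le {c i k : ℕ} (h : i = c + k) : abscissa c i = scale k := by
  subst h
  simp [abscissa]

lemma abscissa_of_add {c i k : ℕ} (h : i + k = c) : abscissa c i = -scale k := by
  rcases Nat.eq_zero_or_pos k with rfl | hk
  · simp [abscissa, ← h, scale]
  · rw [abscissa, if_neg (by omega), show c - i = k by omega]

lemma abscissa_strictMono (c : ℕ) : StrictMono (abscissa c) := by
  intro i j hij
  rcases le_or_gt c i with hi | hi
  · rw [abscissa_of_le (k := i - c) (by omega), abscissa_of_le (k := j - c) (by omega)]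
    exact scale_strictMono (by omega)
  · rw [abscissa_of_add (k := c - i) (by omega)]
    rcases le_or_gt c j with hj | hj
    · rw [abscissa_of_le (k := j - c) (by omega)]
      have h : scale 0 < scale (c - i) := scale_strictMono (by omega)
      linarith [scale_nonneg (j - c), scale_nonneg 0]
    · rw [abscissa_of_add (k := c - j) (by omega)]
      exact neg_lt_neg (scale_strictMono (by omega))

/-- The polygon inscribed in the parabola `y = x ^ 2` with abscissas `abscissa ((n - 1) / 2)`. -/
def parabolaPolygon (n : ℕ) (i : Fin n) : E2 := parabolaPoint (abscissa ((n - 1) / 2) i)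

lemma isConvexPolygon_parabolaPolygon (n : ℕ) : IsConvexPolygon (parabolaPolygon n) := by
  intro i j k hij hjk
  have h1 := abscissa_strictMono ((n - 1) / 2) (show (i : ℕ) < j from hij)
  have h2 := abscissa_strictMono ((n - 1) / 2) (show (j : ℕ) < k from hjk)
  simp only [Ccw, parabolaPolygon, parabolaPoint, PiLp.toLp_apply, Matrix.cons_val_zero,
    Matrix.cons_val_one]
  generalize abscissa ((n - 1) / 2) i = x at *
  generalize abscissa ((n - 1) / 2) j = y at *
  generalize abscissa ((n - 1) / 2) k = z at *
  have := mul_pos (mul_pos (sub_pos.2 h1) (sub_pos.2 h2)) (sub_pos.2 (h1.trans h2))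
  linarith

section

variable {n : ℕ} (i : Fin n)

lemma polyDisk_parabolaPolygon_right {k : ℕ} (hk : (i : ℕ) = (n - 1) / 2 + k)
    (hi : (i : ℕ) + 1 < n) :
    polyDisk (parabolaPolygon n) i = chordDisk (scale k) (scale (k + 1)) := by
  rw [polyDisk, parabolaPolygon, parabolaPolygon, nxt, abscissa_of_le hk]
  simp only [Nat.mod_eq_of_lt hi]
  rw [abscissa_of_le (k := k + 1) (by omega), chordDisk]

lemma polyDisk_parabolaPolygon_left {k : ℕ} (hk : (i : ℕ) + (k + 1) = (n - 1) / 2) :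
    polyDisk (parabolaPolygon n) i = chordDisk (-scale (k + 1)) (-scale k) := by
  rw [polyDisk, parabolaPolygon, parabolaPolygon, nxt, abscissa_of_add hk]
  simp only [Nat.mod_eq_of_lt (show (i : ℕ) + 1 < n by omega)]
  rw [abscissa_of_add (k := k) (by omega), chordDisk]

lemma polyDisk_parabolaPolygon_last {k : ℕ} (hk : (i : ℕ) = (n - 1) / 2 + k)
    (hi : (i : ℕ) + 1 = n) :
    polyDisk (parabolaPolygon n) i = chordDisk (scale k) (-scale ((n - 1) / 2)) := by
  rw [polyDisk, parabolaPolygon, parabolaPolygon, nxt, abscissa_of_le hk]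
  simp only [hi, Nat.mod_self]
  rw [abscissa_of_add (i := 0) (k := (n - 1) / 2) (by omega), chordDisk]

end

lemma polyDisk_inter_nxt {n : ℕ} (p : Fin n → E2) (i : Fin n) :
    (polyDisk p i ∩ polyDisk p (nxt i)).Nonempty := by
  refine ⟨p (nxt i), ?_, ?_⟩ <;> simp [polyDisk, mem_sideDisk_iff]

/-- Sides are grouped by their distance from the vertex of the parabola, two consecutive
distances at a time. -/
def sideClass (n i : ℕ) : ℕ :=
  (if (n - 1) / 2 ≤ i then min (i - (n - 1) / 2) ((n - 1) / 2) else (n - 1) / 2 - 1 - i) / 2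

lemma sideClass_lt {n i : ℕ} (hi : i < n) : sideClass n i < (n + 3) / 4 := by
  unfold sideClass
  split_ifs <;> omega

lemma polyDisk_inter_of_sideClass_eq {n : ℕ} {i j : Fin n} (hij : i < j)
    (h : sideClass n i = sideClass n j) :
    (polyDisk (parabolaPolygon n) i ∩ polyDisk (parabolaPolygon n) j).Nonempty := by
  have hij' : (i : ℕ) < j := hij
  have hj := j.isLt
  by_cases h1 : (i : ℕ) + 1 = j
  · have : j = nxt i := Fin.ext (by simp only [nxt]; rw [Nat.mod_eq_of_lt] <;> omega)
    exact this ▸ polyDisk_inter_nxt _ i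
  by_cases h2 : (i : ℕ) = 0 ∧ (j : ℕ) + 1 = n
  · have : i = nxt j := Fin.ext (by simp only [nxt, h2.2, Nat.mod_self]; omega)
    rw [Set.inter_comm]
    exact this ▸ polyDisk_inter_nxt _ j
  unfold sideClass at h
  by_cases hi : (n - 1) / 2 ≤ (i : ℕ)
  · rw [if_pos hi, if_pos (by omega)] at h
    obtain ⟨k, hk⟩ := Nat.exists_eq_add_of_le hi
    rw [polyDisk_parabolaPolygon_right i hk (by omega),
      polyDisk_parabolaPolygon_last j (k := k + 2) (by omega) (by omega),
      show (n - 1) / 2 = k + 1 by omega]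
    exact chordDisk_inter_closing (scale_nonneg _) (mul_scale_le _) (one_le_scale_succ _)
      (mul_scale_le _)
  · rw [if_neg hi] at h
    rcases le_or_gt ((n - 1) / 2) (j : ℕ) with hjc | hjc
    · rw [if_pos hjc] at h
      obtain ⟨k, hk⟩ := Nat.exists_eq_add_of_le hjc
      obtain ⟨l, hl⟩ : ∃ l, (i : ℕ) + (l + 1) = (n - 1) / 2 := ⟨(n - 1) / 2 - 1 - i, by omega⟩
      rw [polyDisk_parabolaPolygon_left i hl, polyDisk_parabolaPolygon_right j hk (by omega)]
      obtain rfl | rfl | rfl : k = l ∨ k = l + 1 ∨ l = k + 1 := by omega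
      · rw [Set.inter_comm]
        exact chordDisk_inter_mirror (scale_nonneg _) (mul_scale_le _) (one_le_scale_succ _)
      · exact chordDisk_mirror_inter_next (scale_nonneg _) (mul_scale_le _)
          (one_le_scale_succ _) (mul_scale_le _)
      · rw [Set.inter_comm]
        exact chordDisk_inter_next_mirror (scale_nonneg _) (mul_scale_le _)
          (one_le_scale_succ _) (mul_scale_le _)
    · rw [if_neg (by omega)] at h
      omega

lemma polyDisk_inter_eq_empty {n k l : ℕ} (hkl : k + 1 < l) (i j : Fin n)
    (hl' : l ≤ (n - 1) / 2) (hi : (i : ℕ) = (n - 1) / 2 + k) (hj : (j : ℕ) = (n - 1) / 2 + l) :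
    polyDisk (parabolaPolygon n) i ∩ polyDisk (parabolaPolygon n) j = ∅ := by
  rw [Set.eq_empty_iff_forall_notMem]
  rintro q ⟨hqi, hqj⟩
  have hjn := j.isLt
  rw [polyDisk_parabolaPolygon_right i hi (by omega)] at hqi
  have h1 := snd_le_of_mem_chordDisk (scale_nonneg k)
    (scale_strictMono.monotone (Nat.le_succ k)) hqi
  obtain ⟨m, rfl⟩ : ∃ m, l = m + 1 := ⟨l - 1, by omega⟩
  have h2 : scale (k + 1) ≤ scale m := scale_strictMono.monotone (by omega)
  have h3 := mul_scale_le m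
  have h4 := one_le_scale_succ k
  rcases (show (j : ℕ) + 1 ≤ n from hjn).lt_or_eq with hj' | hj'
  · rw [polyDisk_parabolaPolygon_right j hj hj'] at hqj
    have h5 := le_snd_of_mem_chordDisk (scale_nonneg (m + 1))
      (scale_strictMono.monotone (Nat.le_succ _)) hqj
    nlinarith
  · rw [polyDisk_parabolaPolygon_last j hj hj', show (n - 1) / 2 = m + 1 by omega] at hqj
    have h5 := le_snd_of_mem_chordDisk_neg (scale_nonneg (m + 1)) hqj
    nlinarith

/-- For every `n ≥ 3`, there exists a convex `n`-gon whose maximum number of pairwise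
disjoint side disks equals `⌈n/4⌉`. -/
theorem exists_polygon_indep_eq (n : ℕ) (hn : 3 ≤ n) :
    ∃ p : Fin n → E2, IsConvexPolygon p ∧
      (∀ S : Finset (Fin n),
        (∀ i ∈ S, ∀ j ∈ S, i ≠ j → polyDisk p i ∩ polyDisk p j = ∅) →
          S.card ≤ (n + 3) / 4) ∧
      (∃ S : Finset (Fin n),
        (∀ i ∈ S, ∀ j ∈ S, i ≠ j → polyDisk p i ∩ polyDisk p j = ∅) ∧
          S.card = (n + 3) / 4) := by
  refine ⟨parabolaPolygon n, isConvexPolygon_parabolaPolygon n, fun S hS => ?_, ?_⟩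
  · rw [← Finset.card_range ((n + 3) / 4)]
    refine Finset.card_le_card_of_injOn (fun i => sideClass n i)
      (fun i _ => by simpa using sideClass_lt i.isLt) fun i hi j hj h => ?_
    rcases lt_trichotomy i j with hij | hij | hij
    · exact absurd (hS i hi j hj hij.ne)
        (polyDisk_inter_of_sideClass_eq hij h).ne_empty
    · exact hij
    · exact absurd (hS j hj i hi hij.ne)
        (polyDisk_inter_of_sideClass_eq hij h.symm).ne_empty
  · let f (a : Fin ((n + 3) / 4)) : Fin n := ⟨(n - 1) / 2 + 2 * a, by omega⟩
    have hf (a) : (f a : ℕ) = (n - 1) / 2 + 2 * a := rfl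
    have hinj : Function.Injective f := fun a b hab => by
      have := congrArg Fin.val hab
      rw [hf, hf] at this
      exact Fin.ext (by omega)
    refine ⟨Finset.univ.image f, ?_, by
      rw [Finset.card_image_of_injective _ hinj, Finset.card_univ, Fintype.card_fin]⟩
    simp only [Finset.mem_image, Finset.mem_univ, true_and, forall_exists_index,
      forall_apply_eq_imp_iff]
    intro a b hab
    rcases lt_trichotomy (a : ℕ) b with h | h | h
    · exact polyDisk_inter_eq_empty (by omega) _ _ (by omega) (hf a) (hf b)
    · exact absurd (congrArg f (Fin.ext h)) hab
    · rw [Set.inter_comm]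
      exact polyDisk_inter_eq_empty (by omega) _ _ (by omega) (hf b) (hf a)
end
end

section
/- Let P be a convex polygon of n ≥ 3 sides that has an acute interior angle (some interior angle is < π/2) and whose family of side disks is proper (every pair of side disks with nonempty intersection has intersecting interiors). Then for every m ∈ {1, 2, 3, 4}, there exists a convex polygon Q of n + m sides and a set M ⊆ Fin (n+m) of m side indices such that: the m side disks of Q indexed by M pairwise intersect (the induced intersection graph on M is the complete graph K_m), and the intersection graph induced on the remaining n side disks of Q is isomorphic to the side-disk intersection graph G(P). Moreover, if m = 4, then Q also has an acute interior angle and its family of side disks is proper. -/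
noncomputable section

/-- Twice the signed area of the triangle `abc`. -/
def orient (a b c : E2) : ℝ :=
  (b 0 - a 0) * (c 1 - a 1) - (b 1 - a 1) * (c 0 - a 0)

theorem orient_rotate (a b c : E2) : orient a b c = orient b c a := by
  unfold orient; ring

/-- Twice the signed distance between the disks with diameters `ab` and `cd`. -/
def gap (a b c d : E2) : ℝ := ‖a + b - (c + d)‖ - ‖a - b‖ - ‖c - d‖

theorem gap_comm (a b c d : E2) : gap a b c d = gap c d a b := by
  unfold gap; rw [norm_sub_rev (a + b)]; ring

theorem dist_midpoint_midpoint_eq (a b c d : E2) :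
    dist (midpoint ℝ a b) (midpoint ℝ c d) = ‖a + b - (c + d)‖ / 2 := by
  rw [dist_eq_norm, midpoint_eq_smul_add, midpoint_eq_smul_add, ← smul_sub, norm_smul]
  norm_num
  ring

theorem sideDisk_inter_nonempty_iff (a b c d : E2) :
    (sideDisk a b ∩ sideDisk c d).Nonempty ↔ gap a b c d ≤ 0 := by
  rw [← Set.not_disjoint_iff_nonempty_inter, sideDisk, sideDisk,
    disjoint_closedBall_closedBall_iff (by positivity) (by positivity),
    dist_midpoint_midpoint_eq, dist_eq_norm, dist_eq_norm, not_lt, gap]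
  constructor <;> intro h <;> linarith

theorem ball_inter_nonempty_iff {a b c d : E2} (hab : a ≠ b) (hcd : c ≠ d) :
    (Metric.ball (midpoint ℝ a b) (dist a b / 2) ∩
      Metric.ball (midpoint ℝ c d) (dist c d / 2)).Nonempty ↔ gap a b c d < 0 := by
  rw [← Set.not_disjoint_iff_nonempty_inter,
    disjoint_ball_ball_iff (half_pos (dist_pos.2 hab)) (half_pos (dist_pos.2 hcd)),
    dist_midpoint_midpoint_eq, dist_eq_norm, dist_eq_norm, not_le, gap]
  constructor <;> intro h <;> linarith

theorem gap_adjacent_neg {a b c : E2} (h : orient a b c ≠ 0) : gap a b b c < 0 := by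
  have hne : dist a b + dist b c ≠ dist a c := by
    rw [Ne, dist_add_dist_eq_iff]
    rintro ⟨t, -, rfl⟩
    apply h
    simp [orient, AffineMap.lineMap_apply]
    ring
  have := lt_of_le_of_ne (dist_triangle a b c) hne.symm
  simp only [dist_eq_norm] at this
  have e : a + b - (b + c) = a - c := by abel
  rw [gap, e]
  linarith

theorem gap_self_neg {a b c : E2} (h : inner ℝ (a - c) (b - c) < 0) : gap a b c c < 0 := by
  have e₁ : a + b - (c + c) = (a - c) + (b - c) := by abel
  have e₂ : a - b = (a - c) - (b - c) := by abel
  rw [gap, e₁, e₂, sub_self, norm_zero, sub_zero, sub_neg]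
  generalize a - c = u at *
  generalize b - c = v at *
  apply lt_of_pow_lt_pow_left₀ 2 (norm_nonneg _)
  rw [norm_add_sq_real, norm_sub_sq_real]
  linarith

open Filter Topology

theorem eventually_quadratic_ne_zero (A B C : ℝ) (hC : C ≠ 0) :
    ∀ᶠ x in 𝓝[>] (0 : ℝ), A + B * x + C * x ^ 2 ≠ 0 := by
  have aux : ∀ f : ℝ → ℝ, Continuous f → f 0 ≠ 0 → ∀ᶠ x in 𝓝[>] (0 : ℝ), f x ≠ 0 :=
    fun f hf h0 => (hf.continuousAt.eventually_ne h0).filter_mono nhdsWithin_le_nhds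
  have hpos : ∀ᶠ x in 𝓝[>] (0 : ℝ), 0 < x := self_mem_nhdsWithin
  by_cases hA : A = 0
  · by_cases hB : B = 0
    · filter_upwards [hpos] with x hx
      simp [hA, hB, hC, hx.ne']
    · filter_upwards [hpos, aux (fun x => B + C * x) (by fun_prop) (by simpa using hB)] with x hx h
      have := mul_ne_zero hx.ne' h
      intro h0
      apply this
      rw [hA] at h0
      linear_combination h0
  · exact aux _ (by fun_prop) (by simpa using hA)

/-- A small disk cutting a nondegenerate, non-right corner is not externally tangent to a
given disk. -/
theorem eventually_gap_ne_zero (v a b c d : E2) (r : ℝ) (hr : r ≠ 0) (hab : inner ℝ a b ≠ 0) :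
    ∀ᶠ x in 𝓝[>] (0 : ℝ), gap (v + x • a) (v + (r * x) • b) c d ≠ 0 := by
  have hpos : ∀ᶠ x in 𝓝[>] (0 : ℝ), 0 < x := self_mem_nhdsWithin
  have key := eventually_quadratic_ne_zero
    (‖v + v - (c + d)‖ ^ 2 - ‖c - d‖ ^ 2)
    (2 * inner ℝ (v + v - (c + d)) (a + r • b) - 2 * ‖a - r • b‖ * ‖c - d‖)
    (4 * r * inner ℝ a b) (by simp [hr, hab])
  filter_upwards [hpos, key] with x hx h h0
  apply h
  have e₁ : v + x • a + (v + (r * x) • b) - (c + d) = (v + v - (c + d)) + x • (a + r • b) := by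
    module
  have e₂ : v + x • a - (v + (r * x) • b) = x • (a - r • b) := by module
  have n₁ : ‖a + r • b‖ ^ 2 - ‖a - r • b‖ ^ 2 = 4 * r * inner ℝ a b := by
    rw [norm_add_sq_real, norm_sub_sq_real, real_inner_smul_right]; ring
  rw [gap, e₁, e₂, norm_smul, Real.norm_of_nonneg hx.le] at h0
  have h1 : ‖v + v - (c + d) + x • (a + r • b)‖ = x * ‖a - r • b‖ + ‖c - d‖ := by linarith
  have h2 := congrArg (· ^ 2) h1
  simp only [norm_add_sq_real, real_inner_smul_right, norm_smul, Real.norm_of_nonneg hx.le] at h2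
  linear_combination h2 - x ^ 2 * n₁

theorem eventually_neg_iff {f : ℝ → ℝ} (hf : Continuous f) (h0 : f 0 ≠ 0) :
    ∀ᶠ x in 𝓝[>] (0 : ℝ), (f x < 0 ↔ f 0 < 0) ∧ f x ≠ 0 := by
  refine Eventually.filter_mono nhdsWithin_le_nhds ?_
  rcases h0.lt_or_gt with h | h
  · filter_upwards [hf.continuousAt.eventually_lt_const h] with x hx
    exact ⟨iff_of_true hx h, hx.ne⟩
  · filter_upwards [hf.continuousAt.eventually_const_lt h] with x hx
    exact ⟨iff_of_false hx.not_gt h.not_gt, hx.ne'⟩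

theorem eventually_pos {f : ℝ → ℝ} (hf : Continuous f) (h0 : 0 < f 0) :
    ∀ᶠ x in 𝓝[>] (0 : ℝ), 0 < f x :=
  (hf.continuousAt.eventually_const_lt h0).filter_mono nhdsWithin_le_nhds

theorem eventually_forall_lt {n : ℕ} {P : ℕ → ℝ → Prop} {l : Filter ℝ}
    (h : ∀ i < n, ∀ᶠ x in l, P i x) : ∀ᶠ x in l, ∀ i < n, P i x :=
  (eventually_all_finite (Set.finite_lt_nat n)).2 h

theorem angle_lt_pi_div_two_iff (a b c : E2) :
    EuclideanGeometry.angle a b c < Real.pi / 2 ↔ 0 < inner ℝ (a - b) (c - b) := by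
  rw [EuclideanGeometry.angle, InnerProductGeometry.angle, Real.arccos_lt_pi_div_two]
  simp only [vsub_eq_sub]
  constructor
  · intro h
    by_contra! h'
    exact h.not_ge (div_nonpos_of_nonpos_of_nonneg h' (by positivity))
  · intro h
    have h₁ : a - b ≠ 0 := fun h0 => by simp [h0] at h
    have h₂ : c - b ≠ 0 := fun h0 => by simp [h0] at h
    have := norm_pos_iff.2 h₁
    have := norm_pos_iff.2 h₂
    positivity

theorem eventually_orient_pos {a u v w : E2} {r : ℝ}
    (h : 0 < r * orient a v w + orient a u v) :
    ∀ᶠ x in 𝓝[>] (0 : ℝ), 0 < orient a (v + x • (u - v)) (v + (r * x) • (w - v)) := by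
  have hpos : ∀ᶠ x in 𝓝[>] (0 : ℝ), 0 < x := self_mem_nhdsWithin
  have key := eventually_pos (f := fun x => (1 - x) * r * orient a v w +
    (1 - r * x) * orient a u v + x * r * orient a u w) (by fun_prop) (by simpa using h)
  filter_upwards [hpos, key] with x hx h
  refine (mul_pos hx h).trans_eq ?_
  simp only [orient, PiLp.add_apply, PiLp.sub_apply, PiLp.smul_apply, smul_eq_mul]
  ring

/-- Twice the signed distance between the disks on the sides `i` and `j` of the chain `p`. -/
def sideGap (p : ℕ → E2) (i j : ℕ) : ℝ := gap (p i) (p (i + 1)) (p j) (p (j + 1))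

/-- A closed convex polygonal chain `p 0, …, p n = p 0` no two of whose side disks are
externally tangent. -/
structure ProperPolygon (n : ℕ) (p : ℕ → E2) : Prop where
  closed : p n = p 0
  orient_pos : ∀ l < n, ∀ j < l, ∀ i < j, 0 < orient (p i) (p j) (p l)
  gap_ne_zero : ∀ j < n, ∀ i < j, sideGap p i j ≠ 0

/-- Replace the vertex `p k` by two points on the sides meeting there. -/
def cutCorner (p : ℕ → E2) (k : ℕ) (r x : ℝ) (i : ℕ) : E2 :=
  if i < k then p i else if i = k then p k + x • (p (k - 1) - p k)
  else if i = k + 1 then p k + (r * x) • (p (k + 1) - p k) else p (i - 1)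

/-- The index, after cutting the corner `k`, of the side with original index `i`. -/
def oldSide (k i : ℕ) : ℕ := if i < k then i else i + 1

/-- The inner product of the two sides at the vertex `p k`, positive iff the angle is acute. -/
def cornerInner (p : ℕ → E2) (k : ℕ) : ℝ := inner ℝ (p (k - 1) - p k) (p (k + 1) - p k)

/-- The polygon `q` arises from `p` by adding a side at position `k`, preserving intersections
of the old side disks. -/
structure AddsSide (n k : ℕ) (p q : ℕ → E2) : Prop where
  proper : ProperPolygon (n + 1) q
  sideGap_iff : ∀ j < n, ∀ i < j, sideGap q (oldSide k i) (oldSide k j) < 0 ↔ sideGap p i j < 0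

section cutCorner

variable {p : ℕ → E2} {n k : ℕ} {r : ℝ}

theorem cutCorner_of_lt {i : ℕ} (x : ℝ) (h : i < k) : cutCorner p k r x i = p i := by
  simp [cutCorner, h]

theorem cutCorner_left (x : ℝ) : cutCorner p k r x k = p k + x • (p (k - 1) - p k) := by
  simp [cutCorner]

theorem cutCorner_right (x : ℝ) :
    cutCorner p k r x (k + 1) = p k + (r * x) • (p (k + 1) - p k) := by
  simp [cutCorner]

theorem cutCorner_of_gt {i : ℕ} (x : ℝ) (h : k < i) : cutCorner p k r x (i + 1) = p i := by
  simp [cutCorner, show ¬ i + 1 < k by omega, show i + 1 ≠ k by omega, show i ≠ k by omega]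

theorem continuous_cutCorner (i : ℕ) : Continuous fun x => cutCorner p k r x i := by
  unfold cutCorner
  split_ifs <;> fun_prop

theorem cutCorner_zero (i : ℕ) : cutCorner p k r 0 i = p (if i ≤ k then i else i - 1) := by
  unfold cutCorner
  split_ifs <;> first | omega | simp_all

theorem cutCorner_zero_oldSide (i : ℕ) : cutCorner p k r 0 (oldSide k i) = p i := by
  rw [cutCorner_zero, oldSide]
  congr 1
  split_ifs <;> omega

theorem cutCorner_zero_oldSide_succ (i : ℕ) :
    cutCorner p k r 0 (oldSide k i + 1) = p (i + 1) := by
  rw [cutCorner_zero, oldSide]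
  congr 1
  split_ifs <;> omega

theorem continuous_gap {a b c d : ℝ → E2} (ha : Continuous a) (hb : Continuous b)
    (hc : Continuous c) (hd : Continuous d) : Continuous fun x => gap (a x) (b x) (c x) (d x) := by
  unfold gap; fun_prop

theorem continuous_orient {a b c : ℝ → E2} (ha : Continuous a) (hb : Continuous b)
    (hc : Continuous c) : Continuous fun x => orient (a x) (b x) (c x) := by
  unfold orient; fun_prop

theorem eventually_orient_cutCorner_pos (h : ProperPolygon n p) (hk : 0 < k) (hkn : k + 1 < n)
    (hr : 0 < r) : ∀ᶠ x in 𝓝[>] (0 : ℝ), ∀ l < n + 1, ∀ j < l, ∀ i < j,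
      0 < orient (cutCorner p k r x i) (cutCorner p k r x j) (cutCorner p k r x l) := by
  refine eventually_forall_lt fun l hl => eventually_forall_lt fun j hj =>
    eventually_forall_lt fun i hi => ?_
  have orient_self (a b : E2) : orient a b a = 0 := by unfold orient; ring
  by_cases h₁ : j = k ∧ l = k + 1
  · obtain ⟨rfl, rfl⟩ := h₁
    simp only [cutCorner_of_lt _ hi, cutCorner_left, cutCorner_right]
    apply eventually_orient_pos
    have := h.orient_pos (j + 1) hkn j (by omega) i hi
    have : 0 ≤ orient (p i) (p (j - 1)) (p j) := by
      rcases eq_or_ne i (j - 1) with h' | h'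
      · rw [h', orient_rotate, orient_self]
      · exact (h.orient_pos j (by omega) (j - 1) (by omega) i (by omega)).le
    positivity
  by_cases h₂ : i = k ∧ j = k + 1
  · obtain ⟨rfl, rfl⟩ := h₂
    obtain ⟨m, rfl⟩ : ∃ m, l = m + 1 := ⟨l - 1, by omega⟩
    simp only [cutCorner_of_gt _ (show i < m by omega), cutCorner_left, cutCorner_right]
    simp only [← orient_rotate (p m)]
    apply eventually_orient_pos
    have : 0 < orient (p m) (p (i - 1)) (p i) := by
      rw [orient_rotate]
      exact h.orient_pos m (by omega) i (by omega) (i - 1) (by omega)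
    have : 0 ≤ orient (p m) (p i) (p (i + 1)) := by
      rcases eq_or_ne m (i + 1) with h' | h'
      · rw [h', orient_self]
      · rw [orient_rotate]
        exact (h.orient_pos m (by omega) (i + 1) (by omega) i (by omega)).le
    positivity
  · refine eventually_pos (continuous_orient (continuous_cutCorner i) (continuous_cutCorner j)
      (continuous_cutCorner l)) ?_
    simp only [cutCorner_zero]
    apply h.orient_pos <;> split_ifs <;> omega

theorem eventually_gap_oldSide (h : ProperPolygon n p) :
    ∀ᶠ x in 𝓝[>] (0 : ℝ), ∀ j < n, ∀ i < j,
      (sideGap (cutCorner p k r x) (oldSide k i) (oldSide k j) < 0 ↔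
        sideGap p i j < 0) ∧
      sideGap (cutCorner p k r x) (oldSide k i) (oldSide k j) ≠ 0 := by
  refine eventually_forall_lt fun j hj => eventually_forall_lt fun i hi => ?_
  have hc := continuous_cutCorner (p := p) (k := k) (r := r)
  have := eventually_neg_iff (continuous_gap (hc (oldSide k i)) (hc (oldSide k i + 1))
    (hc (oldSide k j)) (hc (oldSide k j + 1)))
  simp only [cutCorner_zero_oldSide, cutCorner_zero_oldSide_succ] at this
  exact this (h.gap_ne_zero j hj i hi)

theorem eventually_gap_newSide_ne_zero (hr : 0 < r)
    (hin : cornerInner p k ≠ 0) :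
    ∀ᶠ x in 𝓝[>] (0 : ℝ), ∀ j < n + 1, j + 1 < k ∨ k + 1 < j →
      sideGap (cutCorner p k r x) k j ≠ 0 := by
  refine eventually_forall_lt fun j hj => ?_
  rw [eventually_imp_distrib_left]
  rintro (hjk | hjk)
  · simp only [sideGap, cutCorner_left, cutCorner_right, cutCorner_of_lt _ (show j < k by omega),
      cutCorner_of_lt _ hjk]
    exact eventually_gap_ne_zero _ _ _ _ _ _ hr.ne' hin
  · obtain ⟨m, rfl⟩ : ∃ m, j = m + 1 := ⟨j - 1, by omega⟩
    simp only [sideGap, cutCorner_left, cutCorner_right, cutCorner_of_gt _ (show k < m by omega),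
      cutCorner_of_gt _ (show k < m + 1 by omega)]
    exact eventually_gap_ne_zero _ _ _ _ _ _ hr.ne' hin

/-- Cutting a small corner that is not right-angled keeps the polygon proper and does not change
which of the old side disks intersect. -/
theorem eventually_addsSide_cutCorner (h : ProperPolygon n p) (hk : 0 < k) (hkn : k + 1 < n)
    (hr : 0 < r) (hin : cornerInner p k ≠ 0) :
    ∀ᶠ x in 𝓝[>] (0 : ℝ), AddsSide n k p (cutCorner p k r x) := by
  filter_upwards [eventually_orient_cutCorner_pos h hk hkn hr,
    eventually_gap_oldSide (k := k) (r := r) h,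
    eventually_gap_newSide_ne_zero (n := n) hr hin] with x ho hold hnew
  refine ⟨⟨?_, ho, fun j hj i hi => ?_⟩, fun j hj i hi => (hold j hj i hi).1⟩
  · rw [cutCorner_of_gt _ (by omega), cutCorner_of_lt _ hk, h.closed]
  by_cases hadj : j = i + 1 ∧ (i = k ∨ j = k)
  · obtain ⟨rfl, hik⟩ := hadj
    exact (gap_adjacent_neg (ho (i + 2) (by omega) (i + 1) (by omega) i (by omega)).ne').ne
  by_cases hik : i = k
  · subst hik
    exact hnew j hj (by omega)
  by_cases hjk : j = k
  · subst hjk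
    rw [sideGap, gap_comm]
    exact hnew i (by omega) (by omega)
  have old {m : ℕ} (hm : m ≠ k) : ∃ m', m = oldSide k m' := by
    unfold oldSide
    rcases lt_or_gt_of_ne hm with h' | h'
    · exact ⟨m, by simp [h']⟩
    · exact ⟨m - 1, by rw [if_neg] <;> omega⟩
  obtain ⟨i', rfl⟩ := old hik
  obtain ⟨j', rfl⟩ := old hjk
  apply (hold j' _ i' _).2 <;> · unfold oldSide at *; split_ifs at * <;> omega

theorem ProperPolygon.sideGap_succ_neg (h : ProperPolygon n p) {i : ℕ} (hi : i + 2 < n) :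
    sideGap p i (i + 1) < 0 :=
  gap_adjacent_neg (h.orient_pos (i + 2) hi (i + 1) (by omega) i (by omega)).ne'

theorem cornerInner_cutCorner_left (hk : 0 < k) (x : ℝ) :
    cornerInner (cutCorner p k r x) k =
      x * ((1 - x) * (r * cornerInner p k - ‖p (k - 1) - p k‖ ^ 2)) := by
  simp only [cornerInner, cutCorner_of_lt _ (show k - 1 < k by omega), cutCorner_left,
    cutCorner_right]
  set a := p (k - 1) - p k with ha
  set b := p (k + 1) - p k
  have e₁ : p (k - 1) - (p k + x • a) = (1 - x) • a := by rw [ha]; module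
  have e₂ : p k + (r * x) • b - (p k + x • a) = (r * x) • b - x • a := by module
  rw [e₁, e₂]
  simp only [inner_smul_left, inner_smul_right, inner_sub_right, real_inner_self_eq_norm_sq]
  simp
  ring

theorem cornerInner_cutCorner_right (x : ℝ) :
    cornerInner (cutCorner p k r x) (k + 1) =
      x * ((1 - r * x) * (cornerInner p k - r * ‖p (k + 1) - p k‖ ^ 2)) := by
  simp only [cornerInner, Nat.add_sub_cancel, cutCorner_of_gt _ (show k < k + 1 by omega),
    cutCorner_left, cutCorner_right]
  set a := p (k - 1) - p k
  set b := p (k + 1) - p k with hb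
  have e₁ : p (k + 1) - (p k + (r * x) • b) = (1 - r * x) • b := by rw [hb]; module
  have e₂ : p k + x • a - (p k + (r * x) • b) = x • a - (r * x) • b := by module
  rw [e₁, e₂]
  simp only [inner_smul_left, inner_smul_right, inner_sub_left, real_inner_self_eq_norm_sq]
  simp
  ring

theorem inner_cutCorner_right (hk : 0 < k) (x : ℝ) :
    inner ℝ (cutCorner p k r x (k - 1) - cutCorner p k r x (k + 1))
        (cutCorner p k r x k - cutCorner p k r x (k + 1)) =
      x * (‖p (k - 1) - p k‖ ^ 2 - r * (1 + x) * cornerInner p k +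
        r ^ 2 * x * ‖p (k + 1) - p k‖ ^ 2) := by
  simp only [cornerInner, cutCorner_of_lt _ (show k - 1 < k by omega), cutCorner_left,
    cutCorner_right]
  set a := p (k - 1) - p k with ha
  set b := p (k + 1) - p k
  have e₁ : p (k - 1) - (p k + (r * x) • b) = a - (r * x) • b := by rw [ha]; module
  have e₂ : p k + x • a - (p k + (r * x) • b) = x • a - (r * x) • b := by module
  rw [e₁, e₂]
  simp only [inner_smul_left, inner_smul_right, inner_sub_right, inner_sub_left,
    real_inner_self_eq_norm_sq, real_inner_comm a b]
  simp
  ring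

/-- An acute corner can be cut so that the second of the two new corners is acute. -/
theorem exists_addsSide_right_acute (h : ProperPolygon n p) (hk : 0 < k) (hkn : k + 1 < n)
    (hin : 0 < cornerInner p k) :
    ∃ q, AddsSide n k p q ∧ 0 < cornerInner q (k + 1) := by
  have hb : 0 < ‖p (k + 1) - p k‖ := norm_pos_iff.2 fun h0 => by
    rw [cornerInner, h0, inner_zero_right] at hin; exact hin.false
  set r := cornerInner p k / (2 * ‖p (k + 1) - p k‖ ^ 2) with hr
  have hr0 : 0 < r := by positivity
  have hrb : r * ‖p (k + 1) - p k‖ ^ 2 = cornerInner p k / 2 := by rw [hr]; field_simp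
  have hpos : ∀ᶠ x in 𝓝[>] (0 : ℝ), 0 < x := self_mem_nhdsWithin
  have h₁ := eventually_pos (f := fun x =>
    (1 - r * x) * (cornerInner p k - r * ‖p (k + 1) - p k‖ ^ 2)) (by fun_prop)
    (by rw [hrb]; simpa using hin)
  obtain ⟨x, hx, h₁, h₂⟩ := (hpos.and (h₁.and
    (eventually_addsSide_cutCorner h hk hkn hr0 hin.ne'))).exists
  exact ⟨_, h₂, by rw [cornerInner_cutCorner_right]; exact mul_pos hx h₁⟩

/-- An acute corner can be cut so that the first of the two new corners is acute, the second one
is obtuse, and the second new vertex is interior to the disk of the side before the cut. -/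
theorem exists_addsSide_left_acute (h : ProperPolygon n p) (hk : 0 < k) (hkn : k + 1 < n)
    (hin : 0 < cornerInner p k) :
    ∃ q, AddsSide n k p q ∧ 0 < cornerInner q k ∧ cornerInner q (k + 1) < 0 ∧
      inner ℝ (q (k - 1) - q (k + 1)) (q k - q (k + 1)) < 0 := by
  have ha : 0 < ‖p (k - 1) - p k‖ := norm_pos_iff.2 fun h0 => by
    rw [cornerInner, h0, inner_zero_left] at hin; exact hin.false
  set r := 2 * ‖p (k - 1) - p k‖ ^ 2 / cornerInner p k with hr
  have hr0 : 0 < r := by positivity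
  have hra : r * cornerInner p k = 2 * ‖p (k - 1) - p k‖ ^ 2 := by rw [hr]; field_simp
  have hcs : cornerInner p k ^ 2 ≤ ‖p (k - 1) - p k‖ ^ 2 * ‖p (k + 1) - p k‖ ^ 2 := by
    rw [← mul_pow]
    exact pow_le_pow_left₀ hin.le (real_inner_le_norm _ _) 2
  have hrb : cornerInner p k < r * ‖p (k + 1) - p k‖ ^ 2 := by
    rw [hr, div_mul_eq_mul_div, lt_div_iff₀ hin]
    nlinarith
  have hpos : ∀ᶠ x in 𝓝[>] (0 : ℝ), 0 < x := self_mem_nhdsWithin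
  have h₁ := eventually_pos (f := fun x =>
    (1 - x) * (r * cornerInner p k - ‖p (k - 1) - p k‖ ^ 2)) (by fun_prop)
    (by rw [hra]; simp; nlinarith)
  have h₂ := eventually_pos (f := fun x =>
    -((1 - r * x) * (cornerInner p k - r * ‖p (k + 1) - p k‖ ^ 2))) (by fun_prop)
    (by simpa using hrb)
  have h₃ := eventually_pos (f := fun x => -(‖p (k - 1) - p k‖ ^ 2 -
    r * (1 + x) * cornerInner p k + r ^ 2 * x * ‖p (k + 1) - p k‖ ^ 2)) (by fun_prop)
    (by simp only [add_zero, mul_one, mul_zero, zero_mul]; rw [hra]; nlinarith)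
  obtain ⟨x, hx, h₁, h₂, h₃, h₄⟩ := (hpos.and (h₁.and (h₂.and (h₃.and
    (eventually_addsSide_cutCorner h hk hkn hr0 hin.ne'))))).exists
  refine ⟨_, h₄, ?_, ?_, ?_⟩
  · rw [cornerInner_cutCorner_left hk]
    exact mul_pos hx h₁
  · rw [cornerInner_cutCorner_right]
    exact mul_neg_of_pos_of_neg hx (neg_pos.1 h₂)
  · rw [inner_cutCorner_right hk]
    exact mul_neg_of_pos_of_neg hx (neg_pos.1 h₃)

/-- An obtuse corner interior to the disk of the side `k` can be cut so that the new disk meets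
that disk, keeping the preceding corner acute. -/
theorem exists_addsSide_obtuse (h : ProperPolygon n p) (hkn : k + 3 < n)
    (hin : cornerInner p (k + 2) < 0) (hacute : 0 < cornerInner p (k + 1))
    (hmem : inner ℝ (p k - p (k + 2)) (p (k + 1) - p (k + 2)) < 0) :
    ∃ q, AddsSide n (k + 2) p q ∧ sideGap q k (k + 2) < 0 ∧ 0 < cornerInner q (k + 1) := by
  have hc := continuous_cutCorner (p := p) (k := k + 2) (r := 1)
  have h₁ := eventually_pos (f := fun x => -sideGap (cutCorner p (k + 2) 1 x) k (k + 2))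
    (continuous_gap (hc _) (hc _) (hc _) (hc _)).neg (by
      simpa [sideGap, cutCorner_zero] using gap_self_neg hmem)
  have h₂ := eventually_pos (f := fun x => cornerInner (cutCorner p (k + 2) 1 x) (k + 1))
    (((hc _).sub (hc _)).inner ((hc _).sub (hc _))) (by
      simpa [cornerInner, cutCorner_zero] using hacute)
  obtain ⟨x, h₁, h₂, h₃⟩ := (h₁.and (h₂.and
    (eventually_addsSide_cutCorner h (by omega) hkn one_pos hin.ne))).exists
  exact ⟨_, h₃, neg_pos.1 h₁, h₂⟩

end cutCorner

/-- The position of the side `i` after `m` sides are inserted behind the side `0`. -/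
def shiftSide (m i : ℕ) : ℕ := if i = 0 then 0 else i + m

theorem oldSide_shiftSide {k m : ℕ} (hk : 0 < k) (hkm : k ≤ m + 1) (i : ℕ) :
    oldSide k (shiftSide m i) = shiftSide (m + 1) i := by
  unfold oldSide shiftSide
  split_ifs <;> omega

theorem shiftSide_lt_shiftSide {m i j : ℕ} (h : i < j) : shiftSide m i < shiftSide m j := by
  unfold shiftSide
  split_ifs <;> omega

theorem shiftSide_lt {m n i : ℕ} (h : i < n) : shiftSide m i < n + m := by
  unfold shiftSide
  split_ifs <;> omega

/-- The sides `1, …, m` of `q` have pairwise intersecting disks, and the other ones reproduce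
the side disk intersections of `p`. -/
structure AttachesClique (n m : ℕ) (p q : ℕ → E2) : Prop where
  proper : ProperPolygon (n + m) q
  clique : ∀ j ≤ m, ∀ i < j, 0 < i → sideGap q i j < 0
  sideGap_iff : ∀ j < n, ∀ i < j,
    sideGap q (shiftSide m i) (shiftSide m j) < 0 ↔ sideGap p i j < 0

theorem AttachesClique.addsSide {n m k : ℕ} {p q q' : ℕ → E2} (h : AttachesClique n m p q)
    (h' : AddsSide (n + m) k q q') (hn : 3 ≤ n) (hk : 0 < k) (hkm : k ≤ m + 1)
    (hfar : ∀ i ≤ m + 1, 0 < i → i + 1 < k ∨ k + 1 < i →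
      sideGap q' (min i k) (max i k) < 0) :
    AttachesClique n (m + 1) p q' where
  proper := h'.proper
  clique j hj i hi h0 := by
    by_cases hadj : j = i + 1
    · rw [hadj]
      exact h'.proper.sideGap_succ_neg (by omega)
    by_cases hik : i = k
    · have := hfar j hj (by omega) (by omega)
      rwa [min_eq_right (by omega), max_eq_left (by omega), ← hik] at this
    by_cases hjk : j = k
    · have := hfar i (by omega) (by omega) (by omega)
      rwa [min_eq_left (by omega), max_eq_right (by omega), ← hjk] at this
    have old {l : ℕ} (hl : l ≠ k) : l = oldSide k (if l < k then l else l - 1) := by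
      unfold oldSide
      split_ifs <;> omega
    rw [old hik, old hjk, h'.sideGap_iff] <;> try (split_ifs <;> omega)
    apply h.clique <;> split_ifs <;> omega
  sideGap_iff j hj i hi := by
    rw [← oldSide_shiftSide hk hkm, ← oldSide_shiftSide hk hkm,
      h'.sideGap_iff _ (shiftSide_lt hj) _ (shiftSide_lt_shiftSide hi), h.sideGap_iff j hj i hi]

theorem exists_attachesClique {n m : ℕ} {p : ℕ → E2} (h : ProperPolygon n p) (hn : 3 ≤ n)
    (hin : 0 < cornerInner p 1) (hm₁ : 1 ≤ m) (hm₂ : m ≤ 4) :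
    ∃ q, AttachesClique n m p q ∧ (m = 4 → 0 < cornerInner q 2) := by
  have h₀ : AttachesClique n 0 p p := by
    refine ⟨h, fun j hj i hi => by omega, fun j hj i hi => ?_⟩
    rw [shiftSide, shiftSide]
    split_ifs <;> simp_all
  obtain ⟨q₁, a₁, c₁⟩ := exists_addsSide_right_acute h one_pos (by omega) hin
  have h₁ := h₀.addsSide a₁ hn one_pos le_rfl (fun i _ _ _ => by omega)
  obtain ⟨q₂, a₂, c₂, -, -⟩ := exists_addsSide_left_acute h₁.proper two_pos (by omega) c₁
  have h₂ := h₁.addsSide a₂ hn two_pos le_rfl (fun i _ _ _ => by omega)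
  obtain ⟨q₃, a₃, c₃, o₃, i₃⟩ := exists_addsSide_left_acute h₂.proper two_pos (by omega) c₂
  have h₃ := h₂.addsSide a₃ hn two_pos (by omega) (fun i _ _ _ => by omega)
  obtain ⟨q₄, a₄, g₄, c₄⟩ := exists_addsSide_obtuse (k := 1) h₃.proper (by omega) o₃ c₃ i₃
  have h₄ := h₃.addsSide a₄ hn three_pos (by omega) (fun i _ _ _ => by
    obtain rfl : i = 1 := by omega
    exact g₄)
  interval_cases m
  · exact ⟨q₁, h₁, by simp⟩
  · exact ⟨q₂, h₂, by simp⟩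
  · exact ⟨q₃, h₃, by simp⟩
  · exact ⟨q₄, h₄, fun _ => c₄⟩

theorem ProperPolygon.ne {n : ℕ} {p : ℕ → E2} (h : ProperPolygon n p) (hn : 3 ≤ n) {i j : ℕ}
    (hij : i < j) (hj : j < n) : p i ≠ p j := by
  intro he
  have orient_self (a b : E2) : orient a b a = 0 ∧ orient a a b = 0 ∧ orient b a a = 0 := by
    unfold orient; refine ⟨?_, ?_, ?_⟩ <;> ring
  obtain ⟨l, hl, hli, hlj⟩ : ∃ l < n, l ≠ i ∧ l ≠ j := by
    by_cases h0 : i = 0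
    · by_cases h1 : j = 1
      · exact ⟨2, by omega, by omega, by omega⟩
      · exact ⟨1, by omega, by omega, by omega⟩
    · exact ⟨0, by omega, by omega, by omega⟩
  rcases lt_or_gt_of_ne hli with h1 | h1
  · exact (h.orient_pos j hj i hij l h1).ne' (by rw [he, (orient_self _ _).2.2])
  rcases lt_or_gt_of_ne hlj with h2 | h2
  · exact (h.orient_pos j hj l h2 i h1).ne' (by rw [he, (orient_self _ _).1])
  · exact (h.orient_pos l hl j h2 i hij).ne' (by rw [he, (orient_self _ _).2.1])

theorem ProperPolygon.ne_succ {n : ℕ} {p : ℕ → E2} (h : ProperPolygon n p) (hn : 3 ≤ n) {i : ℕ}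
    (hi : i < n) : p i ≠ p (i + 1) := by
  rcases (show i + 1 < n ∨ i + 1 = n by omega) with h' | h'
  · exact h.ne hn i.lt_succ_self h'
  · rw [h', h.closed]
    exact (h.ne hn (by omega) hi).symm

theorem sideGap_comm (p : ℕ → E2) (i j : ℕ) : sideGap p i j = sideGap p j i := gap_comm _ _ _ _

theorem ProperPolygon.sideGap_ne_zero {n : ℕ} {p : ℕ → E2} (h : ProperPolygon n p) {i j : ℕ}
    (hi : i < n) (hj : j < n) (hij : i ≠ j) : sideGap p i j ≠ 0 := by
  rcases lt_or_gt_of_ne hij with h' | h'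
  · exact h.gap_ne_zero j hj i h'
  · rw [sideGap_comm]
    exact h.gap_ne_zero i hi j h'

/-- The index obtained from `s` after `t` steps around the polygon. -/
def rotIdx {n : ℕ} (s : Fin n) (t : ℕ) : Fin n := ⟨(s + t) % n, Nat.mod_lt _ s.pos⟩

theorem nxt_rotIdx {n : ℕ} (s : Fin n) (t : ℕ) : nxt (rotIdx s t) = rotIdx s (t + 1) := by
  simp [nxt, rotIdx, add_assoc]

theorem rotIdx_zero {n : ℕ} (s : Fin n) : rotIdx s 0 = s := by
  simp [rotIdx, Nat.mod_eq_of_lt s.isLt]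

theorem rotIdx_self {n : ℕ} (s : Fin n) : rotIdx s n = rotIdx s 0 := by
  simp [rotIdx]

theorem rotIdx_val_cases {n : ℕ} (s : Fin n) {t : ℕ} (ht : t < n) :
    (s + t < n ∧ (rotIdx s t : ℕ) = s + t) ∨ (n ≤ s + t ∧ (rotIdx s t : ℕ) + n = s + t) := by
  have hs := s.isLt
  rcases lt_or_ge ((s : ℕ) + t) n with h | h
  · exact Or.inl ⟨h, Nat.mod_eq_of_lt h⟩
  · refine Or.inr ⟨h, ?_⟩
    simp only [rotIdx]
    rw [Nat.mod_eq_sub_mod h, Nat.mod_eq_of_lt (by omega)]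
    omega

theorem rotIdx_injOn {n : ℕ} (s : Fin n) {t u : ℕ} (ht : t < n) (hu : u < n)
    (h : rotIdx s t = rotIdx s u) : t = u := by
  have := congrArg Fin.val h
  rcases rotIdx_val_cases s ht with h₁ | h₁ <;> rcases rotIdx_val_cases s hu with h₂ | h₂ <;> omega

theorem properPolygon_rotIdx {n : ℕ} {p : Fin n → E2} (hconv : IsConvexPolygon p)
    (hproper : ∀ i j : Fin n, i ≠ j → (polyDisk p i ∩ polyDisk p j).Nonempty →
      (polyBall p i ∩ polyBall p j).Nonempty) (s : Fin n) :
    ProperPolygon n fun t => p (rotIdx s t) where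
  closed := by rw [rotIdx_self]
  orient_pos l hl j hj i hi := by
    have hc : ∀ i j k, i < j → j < k → 0 < orient (p i) (p j) (p k) := hconv
    simp only [Fin.lt_def] at hc
    rcases rotIdx_val_cases s hl with h₁ | h₁ <;>
    rcases rotIdx_val_cases s (hj.trans hl) with h₂ | h₂ <;>
    rcases rotIdx_val_cases s (hi.trans (hj.trans hl)) with h₃ | h₃
    all_goals first
      | exfalso; omega
      | exact hc _ _ _ (by omega) (by omega)
      | rw [orient_rotate]; exact hc _ _ _ (by omega) (by omega)
      | rw [orient_rotate, orient_rotate]; exact hc _ _ _ (by omega) (by omega)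
  gap_ne_zero j hj i hi h0 := by
    have hne : rotIdx s i ≠ rotIdx s j := fun h => hi.ne (rotIdx_injOn s (hi.trans hj) hj h)
    have := hproper _ _ hne (by
      rw [polyDisk, polyDisk, nxt_rotIdx, nxt_rotIdx, sideDisk_inter_nonempty_iff]
      exact h0.le)
    have pos_of_mem {a b x : E2} (hx : x ∈ Metric.ball (midpoint ℝ a b) (dist a b / 2)) : a ≠ b :=
      dist_pos.1 (by linarith [Metric.pos_of_mem_ball hx])
    rw [polyBall, polyBall, nxt_rotIdx, nxt_rotIdx] at this
    obtain ⟨x, hx, hx'⟩ := this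
    exact ((ball_inter_nonempty_iff (pos_of_mem hx) (pos_of_mem hx')).1 ⟨x, hx, hx'⟩).ne h0

theorem polyDisk_rotIdx_inter_nonempty_iff {n : ℕ} {p : Fin n → E2} {s : Fin n}
    (h : ProperPolygon n fun t => p (rotIdx s t)) {i j : ℕ} (hi : i < n) (hj : j < n)
    (hij : i ≠ j) : (polyDisk p (rotIdx s i) ∩ polyDisk p (rotIdx s j)).Nonempty ↔
      sideGap (fun t => p (rotIdx s t)) i j < 0 := by
  rw [polyDisk, polyDisk, nxt_rotIdx, nxt_rotIdx, sideDisk_inter_nonempty_iff,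
    ← sideGap.eq_1 fun t => p (rotIdx s t), (h.sideGap_ne_zero hi hj hij).le_iff_lt]

theorem ProperPolygon.val_nxt {n : ℕ} {q : ℕ → E2} (h : ProperPolygon n q) (i : Fin n) :
    q (nxt i) = q (i + 1) := by
  rcases (show (i : ℕ) + 1 < n ∨ (i : ℕ) + 1 = n by omega) with h' | h'
  · simp [nxt, Nat.mod_eq_of_lt h']
  · simp [nxt, h', h.closed]

theorem ProperPolygon.polyDisk_inter_nonempty_iff {n : ℕ} {q : ℕ → E2} (h : ProperPolygon n q)
    {i j : Fin n} (hij : i ≠ j) :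
    (polyDisk (fun i : Fin n => q i) i ∩ polyDisk (fun i : Fin n => q i) j).Nonempty ↔
      sideGap q i j < 0 := by
  rw [polyDisk, polyDisk, h.val_nxt, h.val_nxt, sideDisk_inter_nonempty_iff,
    ← sideGap.eq_1, (h.sideGap_ne_zero i.isLt j.isLt (Fin.val_ne_of_ne hij)).le_iff_lt]

theorem ProperPolygon.polyBall_inter_nonempty_iff {n : ℕ} {q : ℕ → E2} (h : ProperPolygon n q)
    (hn : 3 ≤ n) {i j : Fin n} :
    (polyBall (fun i : Fin n => q i) i ∩ polyBall (fun i : Fin n => q i) j).Nonempty ↔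
      sideGap q i j < 0 := by
  rw [polyBall, polyBall, h.val_nxt, h.val_nxt,
    ball_inter_nonempty_iff (h.ne_succ hn i.isLt) (h.ne_succ hn j.isLt), sideGap]

theorem sideDiskGraph_adj {n : ℕ} (p : Fin n → E2) (i j : Fin n) :
    (sideDiskGraph p).Adj i j ↔ i ≠ j ∧ (polyDisk p i ∩ polyDisk p j).Nonempty := by
  rw [sideDiskGraph, SimpleGraph.fromRel_adj, Set.inter_comm (polyDisk p j), or_self]

/-- The indices of the sides inserted behind the side `0`. -/
def newSides (n m : ℕ) : Finset (Fin (n + m)) := {i | 0 < (i : ℕ) ∧ (i : ℕ) ≤ m}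

theorem mem_newSides {n m : ℕ} {i : Fin (n + m)} :
    i ∈ newSides n m ↔ 0 < (i : ℕ) ∧ (i : ℕ) ≤ m := by
  simp [newSides]

theorem card_newSides {n m : ℕ} (hn : 0 < n) : (newSides n m).card = m := by
  have : (newSides n m).map Fin.valEmbedding = Finset.Ioc 0 m := by
    ext a
    simp only [Finset.mem_map, mem_newSides, Fin.valEmbedding_apply, Finset.mem_Ioc]
    exact ⟨by rintro ⟨i, hi, rfl⟩; exact hi, fun h => ⟨⟨a, by omega⟩, h, rfl⟩⟩
  rw [← Finset.card_map Fin.valEmbedding, this, Nat.card_Ioc, Nat.sub_zero]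

/-- The old sides are the complement of the new ones. -/
def shiftSideEquiv {n : ℕ} (hn : 0 < n) (m : ℕ) :
    Fin n ≃ ((newSides n m : Set (Fin (n + m)))ᶜ : Set _) :=
  Equiv.ofBijective
    (fun i => ⟨⟨shiftSide m i, shiftSide_lt i.isLt⟩, by
      simp only [Set.mem_compl_iff, Finset.mem_coe, mem_newSides, shiftSide]
      split_ifs <;> omega⟩)
    ⟨fun i j h => by
      simp only [Subtype.mk.injEq, Fin.mk.injEq, shiftSide] at h
      ext
      split_ifs at h <;> omega,
    fun ⟨i, hi⟩ => by
      simp only [Set.mem_compl_iff, Finset.mem_coe, mem_newSides] at hi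
      refine ⟨⟨if (i : ℕ) = 0 then 0 else (i : ℕ) - m, by split_ifs <;> omega⟩, ?_⟩
      ext
      simp only [shiftSide]
      split_ifs <;> omega⟩

theorem AttachesClique.nonempty_iso {n m : ℕ} {p : Fin n → E2} {s : Fin n} {q : ℕ → E2}
    (hn : 0 < n) (hp : ProperPolygon n fun t => p (rotIdx s t))
    (h : AttachesClique n m (fun t => p (rotIdx s t)) q) :
    Nonempty (SimpleGraph.induce ((newSides n m : Set (Fin (n + m)))ᶜ)
      (sideDiskGraph fun i : Fin (n + m) => q i) ≃g sideDiskGraph p) := by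
  have hrot : Function.Bijective fun t : Fin n => rotIdx s t :=
    Finite.injective_iff_bijective.1 fun t u h => Fin.ext (rotIdx_injOn s t.isLt u.isLt h)
  refine ⟨⟨(shiftSideEquiv hn m).symm.trans (Equiv.ofBijective _ hrot), ?_⟩⟩
  intro a b
  obtain ⟨i, rfl⟩ := (shiftSideEquiv hn m).surjective a
  obtain ⟨j, rfl⟩ := (shiftSideEquiv hn m).surjective b
  simp only [Equiv.trans_apply, Equiv.symm_apply_apply, Equiv.ofBijective_apply,
    SimpleGraph.comap_adj, Function.Embedding.subtype_apply, sideDiskGraph_adj]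
  by_cases hij : i = j
  · simp [hij]
  have hij' : (i : ℕ) ≠ j := Fin.val_ne_of_ne hij
  have hne : ((shiftSideEquiv hn m i : Fin (n + m))) ≠ shiftSideEquiv hn m j := fun h0 =>
    hij ((shiftSideEquiv hn m).injective (Subtype.ext h0))
  rw [polyDisk_rotIdx_inter_nonempty_iff hp i.isLt j.isLt hij',
    h.proper.polyDisk_inter_nonempty_iff hne]
  refine and_congr (iff_of_true (hrot.injective.ne hij) hne) ?_
  change _ ↔ sideGap q (shiftSide m i) (shiftSide m j) < 0
  rcases lt_or_gt_of_ne hij' with h' | h'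
  · exact (h.sideGap_iff j j.isLt i h').symm
  · rw [sideGap_comm, sideGap_comm q]
    exact (h.sideGap_iff i i.isLt j h').symm

open EuclideanGeometry in
/-- Let `P` be a convex polygon of `n ≥ 3` sides with an acute interior angle whose side-disk
family is proper. For every `m ∈ {1,2,3,4}` there is a convex polygon `Q` of `n + m` sides and
a set `M` of `m` side indices such that the `m` side disks of `Q` indexed by `M` pairwise
intersect (inducing the complete graph `K_m`), the intersection graph induced on the remaining
`n` side disks of `Q` is isomorphic to `G(P)`, and if `m = 4` then `Q` also has an acute
interior angle and a proper side-disk family. -/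
theorem attach_clique (n : ℕ) (hn : 3 ≤ n) (p : Fin n → E2) (hconv : IsConvexPolygon p)
    (hacute : ∃ i : Fin n, ∠ (p i) (p (nxt i)) (p (nxt (nxt i))) < Real.pi / 2)
    (hproper : ∀ i j : Fin n, i ≠ j → (polyDisk p i ∩ polyDisk p j).Nonempty →
      (polyBall p i ∩ polyBall p j).Nonempty)
    (m : ℕ) (hm₁ : 1 ≤ m) (hm₂ : m ≤ 4) :
    ∃ q : Fin (n + m) → E2, IsConvexPolygon q ∧
      ∃ M : Finset (Fin (n + m)), M.card = m ∧
        (∀ i ∈ M, ∀ j ∈ M, i ≠ j → (polyDisk q i ∩ polyDisk q j).Nonempty) ∧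
        Nonempty
          (SimpleGraph.induce ((M : Set (Fin (n + m)))ᶜ) (sideDiskGraph q) ≃g sideDiskGraph p) ∧
        (m = 4 →
          (∃ i : Fin (n + m), ∠ (q i) (q (nxt i)) (q (nxt (nxt i))) < Real.pi / 2) ∧
          (∀ i j : Fin (n + m), i ≠ j → (polyDisk q i ∩ polyDisk q j).Nonempty →
            (polyBall q i ∩ polyBall q j).Nonempty)) := by
  obtain ⟨s, hs⟩ := hacute
  have hp := properPolygon_rotIdx hconv hproper s
  have hin : 0 < cornerInner (fun t => p (rotIdx s t)) 1 := by
    have e₁ : nxt s = rotIdx s 1 := by rw [← nxt_rotIdx, rotIdx_zero]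
    rw [e₁, nxt_rotIdx, angle_lt_pi_div_two_iff] at hs
    simpa [cornerInner, rotIdx_zero] using hs
  obtain ⟨q, hq, hq4⟩ := exists_attachesClique hp hn hin hm₁ hm₂
  refine ⟨fun i => q i, fun i j k hij hjk => hq.proper.orient_pos k k.isLt j hjk i hij,
    newSides n m, card_newSides (by omega), fun i hi j hj hij => ?_, hq.nonempty_iso (by omega) hp,
    fun hm => ⟨⟨⟨1, by omega⟩, ?_⟩, fun i j hij hne => ?_⟩⟩
  · rw [mem_newSides] at hi hj
    rw [hq.proper.polyDisk_inter_nonempty_iff hij]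
    rcases lt_or_gt_of_ne hij with h | h
    · exact hq.clique j hj.2 i h hi.1
    · rw [sideGap_comm]
      exact hq.clique i hi.2 j h hj.1
  · have h₁ : (nxt ⟨1, by omega⟩ : Fin (n + m)) = ⟨2, by omega⟩ := by
      simp [nxt, Nat.mod_eq_of_lt (show 2 < n + m by omega)]
    have h₂ : (nxt ⟨2, by omega⟩ : Fin (n + m)) = ⟨3, by omega⟩ := by
      simp [nxt, Nat.mod_eq_of_lt (show 3 < n + m by omega)]
    rw [h₁, h₂, angle_lt_pi_div_two_iff]
    exact hq4 hm
  · rw [hq.proper.polyDisk_inter_nonempty_iff hij] at hne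
    exact (hq.proper.polyBall_inter_nonempty_iff (by omega)).2 hne
end
end
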